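/- arXiv:math/0612161 — 2 statements merged into one kernel-verified Lean document; each statement's English description precedes it below -/
import Mathlib

section
/- Let a ≥ 1, b ≥ 0 and let M = U^a ⊕ E8(−1)^b. Then the isometry group O(M) acts transitively on the set of (−2)-vectors of M: for any δ_1, δ_2 ∈ M with ⟨δ_1,δ_1⟩ = ⟨δ_2,δ_2⟩ = −2, there exists g ∈ O(M) with g(δ_1) = δ_2. -/
open Matrix

/-- Gram matrix of the hyperbolic plane `U`. -/
def gramU : Matrix (Fin 2) (Fin 2) ℤ := !![0, 1; 1, 0]

/-- Gram matrix of `E8(−1)`, the negative of the E₈ Cartan (Gram) matrix. -/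
def gramE8neg : Matrix (Fin 8) (Fin 8) ℤ := - CartanMatrix.E₈

/-- Index type for the lattice `L = U^a ⊕ E8(−1)^b`. -/
abbrev IdxL (a b : ℕ) := (Fin 2 × Fin a) ⊕ (Fin 8 × Fin b)

/-- Gram matrix of `L = U^a ⊕ E8(−1)^b`. -/
def gramL (a b : ℕ) : Matrix (IdxL a b) (IdxL a b) ℤ :=
  Matrix.fromBlocks (Matrix.blockDiagonal fun _ => gramU) 0 0
    (Matrix.blockDiagonal fun _ => gramE8neg)

/-- The bilinear form on `M = U^a ⊕ E8(−1)^b`. -/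
def bilL (a b : ℕ) (x y : IdxL a b → ℤ) : ℤ := x ⬝ᵥ (gramL a b).mulVec y

section Abstract

variable {W : Type*} [AddCommGroup W] [Module ℚ W] {B : LinearMap.BilinForm ℚ W}

/-- The isometries of a rational bilinear space. -/
def IsIsometry (B : LinearMap.BilinForm ℚ W) (g : W ≃ₗ[ℚ] W) : Prop :=
  ∀ x y, B (g x) (g y) = B x y

lemma IsIsometry.symm {g : W ≃ₗ[ℚ] W} (hg : IsIsometry B g) : IsIsometry B g.symm := fun x y => by
  rw [← hg, g.apply_symm_apply, g.apply_symm_apply]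

lemma IsIsometry.trans {g h : W ≃ₗ[ℚ] W} (hg : IsIsometry B g) (hh : IsIsometry B h) :
    IsIsometry B (g.trans h) := fun x y => by
  rw [LinearEquiv.trans_apply, LinearEquiv.trans_apply, hh, hg]

/-- The Eichler transvection attached to an isotropic vector `e` and a vector `u` orthogonal
to it. -/
lemma exists_eichler (hB : ∀ x y, B x y = B y x) {e u : W} (he : B e e = 0) (hu : B e u = 0) :
    ∃ g : W ≃ₗ[ℚ] W, IsIsometry B g ∧
      (∀ x, g x = x + B e x • u - B u x • e - (B u u / 2 * B e x) • e) ∧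
      (∀ x, g.symm x = x - B e x • u + B u x • e - (B u u / 2 * B e x) • e) := by
  have hu' : B u e = 0 := by rw [hB, hu]
  let φ : W → W →ₗ[ℚ] W := fun u => LinearMap.id + (B e).smulRight u - (B u).smulRight e -
    (B u u / 2) • (B e).smulRight e
  have hφ : ∀ u x, φ u x = x + B e x • u - B u x • e - (B u u / 2 * B e x) • e := by
    intro u x
    simp [φ, mul_smul]
  have key : ∀ u, B e u = 0 → B u e = 0 → φ u ∘ₗ φ (-u) = LinearMap.id := by
    intro u h h'
    ext x
    simp only [LinearMap.comp_apply, hφ, LinearMap.id_apply, map_add, map_sub, map_smul, map_neg,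
      LinearMap.neg_apply, h, h', he, smul_eq_mul]
    module
  refine ⟨LinearEquiv.ofLinearMap (φ u) (φ (-u)) (key u hu hu') ?_, ?_, fun x => ?_, fun x => ?_⟩
  · simpa using key (-u) (by simp [hu]) (by simp [hu'])
  · intro x y
    simp only [LinearEquiv.coe_ofLinearMap, hφ, map_add, map_sub, map_smul, hB x e, hB x u,
      LinearMap.add_apply, LinearMap.sub_apply, LinearMap.smul_apply, hu, hu', he, smul_eq_mul]
    ring
  · simp [hφ]
  · simp [hφ, sub_eq_add_neg]

lemma exists_scaling (hB : ∀ x y, B x y = B y x) {e f : W} (he : B e e = 0) (hf : B f f = 0)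
    (hef : B e f = 1) {c : ℚ} (hc : c ≠ 0) :
    ∃ g : W ≃ₗ[ℚ] W, IsIsometry B g ∧ g e = c • e ∧ g f = c⁻¹ • f ∧
      ∀ x, B e x = 0 → B f x = 0 → g x = x := by
  have hfe : B f e = 1 := by rw [hB, hef]
  let φ : ℚ → W →ₗ[ℚ] W := fun c => LinearMap.id + (c - 1) • (B f).smulRight e +
    (c⁻¹ - 1) • (B e).smulRight f
  have hφ : ∀ c x, φ c x = x + ((c - 1) * B f x) • e + ((c⁻¹ - 1) * B e x) • f := by
    intro c x
    simp [φ, mul_smul]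
  have key : ∀ c, c ≠ 0 → φ c ∘ₗ φ c⁻¹ = LinearMap.id := by
    intro c hc
    ext x
    simp only [LinearMap.comp_apply, hφ, LinearMap.id_apply, map_add, map_smul,
      hef, hfe, he, hf, smul_eq_mul, inv_inv]
    match_scalars <;> field_simp <;> ring
  refine ⟨LinearEquiv.ofLinearMap (φ c) (φ c⁻¹) (key c hc) ?_, ?_, ?_, ?_, fun x h h' => ?_⟩
  · simpa using key c⁻¹ (inv_ne_zero hc)
  · intro x y
    simp only [LinearEquiv.coe_ofLinearMap, hφ, map_add, map_smul, hB x e, hB x f,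
      LinearMap.add_apply, LinearMap.smul_apply, hef, hfe, he, hf, smul_eq_mul]
    field_simp
    ring
  · simp only [LinearEquiv.coe_ofLinearMap, hφ, he, hfe]
    module
  · simp only [LinearEquiv.coe_ofLinearMap, hφ, hf, hef]
    module
  · simp [hφ, h, h']

lemma exists_reflection (hB : ∀ x y, B x y = B y x) {u : W} (hu : B u u ≠ 0) :
    ∃ g : W ≃ₗ[ℚ] W, IsIsometry B g ∧ ∀ x, g x = x - (2 * B u x / B u u) • u := by
  let φ : W →ₗ[ℚ] W := LinearMap.id - (2 / B u u) • (B u).smulRight u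
  have hφ : ∀ x, φ x = x - (2 * B u x / B u u) • u := by
    intro x
    simp only [φ, LinearMap.sub_apply, LinearMap.smul_apply, LinearMap.id_apply,
      LinearMap.smulRight_apply]
    module
  have key : φ ∘ₗ φ = LinearMap.id := by
    ext x
    simp only [LinearMap.comp_apply, hφ, LinearMap.id_apply, map_sub, map_smul, smul_eq_mul]
    match_scalars <;> field_simp
    ring
  refine ⟨LinearEquiv.ofLinearMap φ φ key key, ?_, hφ⟩
  intro x y
  simp only [LinearEquiv.coe_ofLinearMap, hφ, map_sub, map_smul, hB x u,
    LinearMap.sub_apply, LinearMap.smul_apply, smul_eq_mul]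
  field_simp
  ring

/-- Witt's theorem for two vectors of the same nonzero norm. -/
lemma exists_isometry_apply_eq (hB : ∀ x y, B x y = B y x) {v w : W} (hvw : B v v = B w w)
    (hv : B v v ≠ 0) : ∃ g : W ≃ₗ[ℚ] W, IsIsometry B g ∧ g v = w := by
  by_cases h : B (v - w) (v - w) = 0
  · have h' : B (v + w) (v + w) ≠ 0 := by
      intro h'
      simp only [map_sub, map_add, LinearMap.sub_apply, LinearMap.add_apply] at h h'
      exact hv (by linarith)
    obtain ⟨g, hg, hgx⟩ := exists_reflection hB h'
    refine ⟨g.trans (LinearEquiv.neg ℚ), hg.trans fun x y => by simp, ?_⟩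
    have h2 : 2 * B (v + w) v / B (v + w) (v + w) = 1 := by
      rw [div_eq_one_iff_eq h']
      simp only [map_add, LinearMap.add_apply, hB w v]
      linarith
    rw [LinearEquiv.trans_apply, hgx, h2, LinearEquiv.neg_apply]
    module
  · obtain ⟨g, hg, hgx⟩ := exists_reflection hB h
    refine ⟨g, hg, ?_⟩
    have h2 : 2 * B (v - w) v / B (v - w) (v - w) = 1 := by
      rw [div_eq_one_iff_eq h]
      simp only [map_sub, LinearMap.sub_apply, hB w v]
      linarith
    rw [hgx, h2]
    module

/-- Even unimodular lattices in a rational bilinear space, unimodularity being expressed as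
self-duality. -/
structure IsEvenUnimodular (B : LinearMap.BilinForm ℚ W) (N : Submodule ℤ W) : Prop where
  mem_of_forall : ∀ y, (∀ x ∈ N, ∃ k : ℤ, B x y = k) → y ∈ N
  integral : ∀ x ∈ N, ∀ y ∈ N, ∃ k : ℤ, B x y = k
  even : ∀ x ∈ N, ∃ k : ℤ, B x x = 2 * k
  exists_smul_mem : ∀ x, ∃ n : ℕ, 0 < n ∧ (n : ℚ) • x ∈ N

/-- Some isometry of the ambient space takes the lattice `N` to `N'` and `v` to `v'`. -/
def PairEquiv (B : LinearMap.BilinForm ℚ W) (N : Submodule ℤ W) (v : W) (N' : Submodule ℤ W)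
    (v' : W) : Prop :=
  ∃ g : W ≃ₗ[ℚ] W, IsIsometry B g ∧ (∀ x, g x ∈ N' ↔ x ∈ N) ∧ g v = v'

lemma PairEquiv.symm {N N' : Submodule ℤ W} {v v' : W} (h : PairEquiv B N v N' v') :
    PairEquiv B N' v' N v := by
  obtain ⟨g, hg, hN, rfl⟩ := h
  exact ⟨g.symm, hg.symm, fun x => by rw [← hN, g.apply_symm_apply], by simp⟩

lemma PairEquiv.trans {N N' N'' : Submodule ℤ W} {v v' v'' : W} (h : PairEquiv B N v N' v')
    (h' : PairEquiv B N' v' N'' v'') : PairEquiv B N v N'' v'' := by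
  obtain ⟨g, hg, hN, rfl⟩ := h
  obtain ⟨g', hg', hN', rfl⟩ := h'
  exact ⟨g.trans g', hg.trans hg', fun x => by simp [hN, hN'], by simp⟩

lemma ratCast_int_smul_mem {N : Submodule ℤ W} {x : W} (hx : x ∈ N) (k : ℤ) : (k : ℚ) • x ∈ N := by
  rw [Int.cast_smul_eq_zsmul]
  exact N.smul_mem k hx

lemma smul_mem_of_eq_intCast {N : Submodule ℤ W} {x : W} (hx : x ∈ N) {q : ℚ}
    (hq : ∃ k : ℤ, q = k) : q • x ∈ N := by
  obtain ⟨k, rfl⟩ := hq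
  exact ratCast_int_smul_mem hx k

/-- The preimage of a lattice under a linear automorphism. -/
def pullback (g : W ≃ₗ[ℚ] W) (N : Submodule ℤ W) : Submodule ℤ W :=
  N.comap (g.toLinearMap.restrictScalars ℤ)

lemma mem_pullback {g : W ≃ₗ[ℚ] W} {N : Submodule ℤ W} {x : W} : x ∈ pullback g N ↔ g x ∈ N :=
  Iff.rfl

lemma IsEvenUnimodular.pullback {N : Submodule ℤ W} (hN : IsEvenUnimodular B N) {g : W ≃ₗ[ℚ] W}
    (hg : IsIsometry B g) : IsEvenUnimodular B (pullback g N) where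
  mem_of_forall y hy := hN.mem_of_forall _ fun x hx => by
    obtain ⟨k, hk⟩ := hy (g.symm x) (by simpa [mem_pullback] using hx)
    exact ⟨k, by rw [← hk, ← hg (g.symm x), g.apply_symm_apply]; rfl⟩
  integral x hx y hy := by rw [← hg]; exact hN.integral _ hx _ hy
  even x hx := by rw [← hg]; exact hN.even _ hx
  exists_smul_mem x := by
    obtain ⟨n, hn, h⟩ := hN.exists_smul_mem (g x)
    exact ⟨n, hn, by rwa [mem_pullback, map_smul]⟩

lemma pairEquiv_pullback {N : Submodule ℤ W} {g : W ≃ₗ[ℚ] W} (hg : IsIsometry B g) (v : W) :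
    PairEquiv B (pullback g N) v N (g v) :=
  ⟨g, hg, fun _ => Iff.rfl, rfl⟩

/-- A norm `-2` vector of an even unimodular lattice has divisibility one. -/
lemma IsEvenUnimodular.exists_pairing_eq_one {N : Submodule ℤ W} (hN : IsEvenUnimodular B N)
    {v : W} (hv : v ∈ N) (hvv : B v v = -2) : ∃ u ∈ N, B u v = 1 := by
  by_contra! H
  have hmem : (1 / 2 : ℚ) • v ∈ N := by
    refine hN.mem_of_forall _ fun x hx => ?_
    obtain ⟨k, hk⟩ := hN.integral x hx v hv
    obtain ⟨m, rfl | rfl⟩ := Int.even_or_odd' k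
    · exact ⟨m, by rw [map_smul, hk, smul_eq_mul]; push_cast; ring⟩
    · refine absurd ?_ (H (x + (m : ℚ) • v) (N.add_mem hx (ratCast_int_smul_mem hv m)))
      rw [map_add, map_smul, LinearMap.add_apply, LinearMap.smul_apply, hk, hvv, smul_eq_mul]
      push_cast
      ring
  obtain ⟨k, hk⟩ := hN.even _ hmem
  simp only [map_smul, LinearMap.smul_apply, hvv, smul_eq_mul] at hk
  have : (4 * k : ℚ) = -1 := by linarith
  norm_cast at this
  omega

/-- Some multiple of a vector is in the lattice and has divisibility one. -/
lemma IsEvenUnimodular.exists_smul_pairing_eq_one {N : Submodule ℤ W}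
    (hN : IsEvenUnimodular B N) {e f : W} (hfe : B f e = 1) :
    ∃ c : ℚ, c ≠ 0 ∧ c • e ∈ N ∧ ∃ w ∈ N, B w (c • e) = 1 := by
  obtain ⟨n, hn, hne⟩ := hN.exists_smul_mem e
  let I : Ideal ℤ :=
    { carrier := {k | ∃ w ∈ N, B w ((n : ℚ) • e) = k}
      add_mem' := by
        rintro a b ⟨w, hw, ha⟩ ⟨w', hw', hb⟩
        exact ⟨w + w', N.add_mem hw hw', by
          rw [map_add, LinearMap.add_apply, ha, hb, Int.cast_add]⟩
      zero_mem' := ⟨0, N.zero_mem, by simp⟩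
      smul_mem' := by
        rintro c a ⟨w, hw, ha⟩
        exact ⟨(c : ℚ) • w, ratCast_int_smul_mem hw c, by
          rw [map_smul B, LinearMap.smul_apply, ha, smul_eq_mul, smul_eq_mul, Int.cast_mul]⟩ }
  obtain ⟨d, hd⟩ := (IsPrincipalIdealRing.principal I).principal
  have hdI : d ∈ I := by rw [hd]; exact Submodule.mem_span_singleton_self d
  have hdvd : ∀ k ∈ I, d ∣ k := by
    intro k hk
    rw [hd] at hk
    exact Ideal.mem_span_singleton.1 hk
  obtain ⟨w, hw, hwd⟩ := hdI
  have hd0 : (d : ℚ) ≠ 0 := by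
    rw [Int.cast_ne_zero]
    rintro rfl
    obtain ⟨m, hm, hmf⟩ := hN.exists_smul_mem f
    have := hdvd (m * n : ℤ) ⟨_, hmf, by simp [hfe, mul_comm]⟩
    rw [zero_dvd_iff] at this
    have : 0 < (m * n : ℤ) := by positivity
    omega
  have hn0 : (n : ℚ) ≠ 0 := by positivity
  have hc : ((n : ℚ) / d) • e = (d : ℚ)⁻¹ • (n : ℚ) • e := by
    rw [smul_smul, div_eq_inv_mul]
  refine ⟨n / d, div_ne_zero hn0 hd0, ?_, w, hw, ?_⟩
  · refine hN.mem_of_forall _ fun x hx => ?_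
    obtain ⟨k, hk⟩ := hN.integral x hx _ hne
    obtain ⟨t, rfl⟩ := hdvd k ⟨x, hx, hk⟩
    refine ⟨t, ?_⟩
    rw [hc, map_smul, hk, smul_eq_mul]
    push_cast
    field_simp
  · rw [hc, map_smul, hwd, smul_eq_mul, inv_mul_cancel₀ hd0]

/-- Bases of hyperbolic planes. -/
structure IsHyperbolicPair (B : LinearMap.BilinForm ℚ W) (e f : W) : Prop where
  left : B e e = 0
  right : B f f = 0
  pairing : B e f = 1
  pairing' : B f e = 1

lemma IsHyperbolicPair.swap {e f : W} (h : IsHyperbolicPair B e f) : IsHyperbolicPair B f e :=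
  ⟨h.right, h.left, h.pairing', h.pairing⟩

/-- The projection to the orthogonal complement of a hyperbolic pair. -/
lemma IsHyperbolicPair.exists_orthogonal {e f : W}
    (h : IsHyperbolicPair B e f)
    {N : Submodule ℤ W} (hN : IsEvenUnimodular B N) (he : e ∈ N) (hf : f ∈ N) {x : W}
    (hx : x ∈ N) : ∃ y ∈ N, B e y = 0 ∧ B f y = 0 ∧
      ∃ m n : ℤ, x = y + (m : ℚ) • e + (n : ℚ) • f := by
  obtain ⟨m, hm⟩ := hN.integral f hf x hx
  obtain ⟨n, hn⟩ := hN.integral e he x hx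
  refine ⟨x - (m : ℚ) • e - (n : ℚ) • f, N.sub_mem (N.sub_mem hx (ratCast_int_smul_mem he m))
    (ratCast_int_smul_mem hf n), ?_, ?_, m, n, by module⟩
  · simp only [map_sub, map_smul, hn, h.left, h.pairing, smul_eq_mul]
    ring
  · simp only [map_sub, map_smul, hm, h.right, h.pairing', smul_eq_mul]
    ring

lemma IsHyperbolicPair.exists_orthogonal_pairing {e f : W}
    (h : IsHyperbolicPair B e f)
    {N : Submodule ℤ W} (hN : IsEvenUnimodular B N) (he : e ∈ N) (hf : f ∈ N) {x : W}
    (hx : x ∈ N) {v : W} (hev : B e v = 0) (hfv : B f v = 0) :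
    ∃ y ∈ N, B e y = 0 ∧ B f y = 0 ∧ B y v = B x v := by
  obtain ⟨y, hy, hey, hfy, m, n, rfl⟩ := h.exists_orthogonal hN he hf hx
  exact ⟨y, hy, hey, hfy, by simp [hev, hfv]⟩

/-- An integral multiple of one half of a hyperbolic pair can be removed from a norm `-2` vector
orthogonal to the pair. -/
lemma pairEquiv_add_smul (hB : ∀ x y, B x y = B y x) {e f v : W} (h : IsHyperbolicPair B e f)
    {N : Submodule ℤ W} (hN : IsEvenUnimodular B N) (he : e ∈ N) (hf : f ∈ N) (hv : v ∈ N)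
    (hvv : B v v = -2) (hev : B e v = 0) (hfv : B f v = 0) (m : ℤ) :
    PairEquiv B N (v + (m : ℚ) • e) N v := by
  obtain ⟨u₀, hu₀, hu₀v⟩ := hN.exists_pairing_eq_one hv hvv
  obtain ⟨u₁, hu₁, heu₁, -, hu₁v⟩ := h.exists_orthogonal_pairing hN he hf hu₀ hev hfv
  set u := (m : ℚ) • u₁ with hu_def
  have hu : u ∈ N := ratCast_int_smul_mem hu₁ m
  have heu : B e u = 0 := by simp [hu_def, heu₁]
  have huv : B u v = m := by simp [hu_def, hu₁v, hu₀v]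
  obtain ⟨g, hg, hgx, hgs⟩ := exists_eichler hB h.left heu
  have hcoef : ∀ x ∈ N, ∃ k : ℤ, B u u / 2 * B e x = k := by
    intro x hx
    obtain ⟨a, ha⟩ := hN.even u hu
    obtain ⟨b, hb⟩ := hN.integral e he x hx
    exact ⟨a * b, by rw [ha, hb]; push_cast; ring⟩
  have h1 : ∀ x ∈ N, g x ∈ N := fun x hx => by
    rw [hgx]
    exact N.sub_mem (N.sub_mem (N.add_mem hx (smul_mem_of_eq_intCast hu (hN.integral e he x hx)))
      (smul_mem_of_eq_intCast he (hN.integral u hu x hx))) (smul_mem_of_eq_intCast he (hcoef x hx))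
  have h2 : ∀ x ∈ N, g.symm x ∈ N := fun x hx => by
    rw [hgs]
    exact N.sub_mem (N.add_mem (N.sub_mem hx (smul_mem_of_eq_intCast hu (hN.integral e he x hx)))
      (smul_mem_of_eq_intCast he (hN.integral u hu x hx))) (smul_mem_of_eq_intCast he (hcoef x hx))
  refine ⟨g, hg, fun x => ⟨fun hx => by simpa using h2 _ hx, h1 x⟩, ?_⟩
  have hue : B u e = 0 := by rw [hB, heu]
  rw [hgx]
  simp only [map_add, map_smul, huv, hev, h.left, hue, smul_eq_mul]
  module

/-- A vector of prime order modulo a lattice pairs to `1 / p` with some lattice vector. -/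
lemma IsEvenUnimodular.exists_pairing_eq_inv_sub {N : Submodule ℤ W}
    (hN : IsEvenUnimodular B N) {x : W} (hx : x ∉ N) {p : ℕ} (hp : p.Prime)
    (hpx : (p : ℚ) • x ∈ N) : ∃ w ∈ N, ∃ t : ℤ, B w x = (p : ℚ)⁻¹ - t := by
  have hp0 : (p : ℚ) ≠ 0 := by exact_mod_cast hp.ne_zero
  obtain ⟨w, hw, hwx⟩ : ∃ w ∈ N, ¬ ∃ k : ℤ, B w x = k := by
    by_contra! H
    exact hx (hN.mem_of_forall x H)
  obtain ⟨c, hc⟩ := hN.integral w hw _ hpx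
  rw [map_smul, smul_eq_mul] at hc
  have hpc : ¬ (p : ℤ) ∣ c := by
    rintro ⟨s, rfl⟩
    refine hwx ⟨s, ?_⟩
    push_cast at hc
    exact mul_left_cancel₀ hp0 hc
  obtain ⟨q, r, hqr⟩ := (Nat.prime_iff_prime_int.1 hp).irreducible.coprime_iff_not_dvd.2 hpc
  refine ⟨(r : ℚ) • w, ratCast_int_smul_mem hw r, q, ?_⟩
  have hqr' : (q * p + r * c : ℚ) = 1 := by exact_mod_cast hqr
  rw [map_smul, LinearMap.smul_apply, smul_eq_mul]
  field_simp
  linear_combination (r : ℚ) * hc + hqr'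

/-- The neighbour of `N` at `x`, where `N` splits off a hyperbolic plane orthogonal to `x`, is
isometric to `N`. -/
lemma exists_neighbor (hB : ∀ x y, B x y = B y x) {e f v x : W} (h : IsHyperbolicPair B e f)
    {N : Submodule ℤ W} (hN : IsEvenUnimodular B N) (he : e ∈ N) (hf : f ∈ N) (hv : v ∈ N)
    (hvv : B v v = -2) (hev : B e v = 0) (hfv : B f v = 0) (hxN : x ∉ N) {p : ℕ} (hp : p.Prime)
    (hpx : (p : ℚ) • x ∈ N) (hex : B e x = 0) (hfx : B f x = 0) {k : ℤ} (hxx : B x x = 2 * k)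
    {l : ℤ} (hxv : B x v = l) :
    ∃ N₁ : Submodule ℤ W, IsEvenUnimodular B N₁ ∧ x ∈ N₁ ∧
      (∀ y ∈ N, (∃ a : ℤ, B x y = a) → y ∈ N₁) ∧ PairEquiv B N₁ v N v := by
  have hp0 : (p : ℚ) ≠ 0 := by exact_mod_cast hp.ne_zero
  obtain ⟨w₀, hw₀, t, hwt₀⟩ := hN.exists_pairing_eq_inv_sub hxN hp hpx
  obtain ⟨w, hw, hew, hfw, hwt⟩ := h.exists_orthogonal_pairing hN he hf hw₀ hex hfx
  rw [hwt₀] at hwt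
  obtain ⟨j, hj⟩ := hN.even w hw
  have hxw : B x w = (p : ℚ)⁻¹ - t := by rw [hB, hwt]
  have hxe : B x e = 0 := by rw [hB, hex]
  have hxf : B x f = 0 := by rw [hB, hfx]
  have hwe : B w e = 0 := by rw [hB, hew]
  have hwf : B w f = 0 := by rw [hB, hfw]
  obtain ⟨D, hD, hDe, hDf, hDy⟩ := exists_scaling hB h.left h.right h.pairing hp0
  obtain ⟨T, hT, hTx, -⟩ := exists_eichler hB h.left (u := (p : ℚ) • w) (by simp [hew])
  obtain ⟨E, hE, hEx, -⟩ := exists_eichler hB h.right hfx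
  set g := (D.trans T).trans E with hg_def
  have hg : IsIsometry B g := (hD.trans hT).trans hE
  have hge : g e = (p : ℚ) • e + (p : ℚ) • x - (p * k : ℚ) • f := by
    simp only [hg_def, LinearEquiv.trans_apply, hDe, hTx, hEx, map_smul, map_add, map_sub,
      LinearMap.smul_apply, h.left, h.pairing', hwe, hxe, hxx, smul_eq_mul]
    match_scalars <;> ring
  have hgf : g f = (t : ℚ) • f + w - (p * j : ℚ) • e - (j : ℚ) • (p : ℚ) • x +
      (p * j * k : ℚ) • f := by
    simp only [hg_def, LinearEquiv.trans_apply, hDf, hTx, hEx, map_smul, map_add, map_sub,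
      LinearMap.smul_apply, h.right, h.pairing, h.pairing', hwf, hxe, hxf, hxx, hj, hfw,
      hxw, smul_eq_mul]
    match_scalars <;> field_simp <;> ring
  have hgy : ∀ y, B e y = 0 → B f y = 0 → g y = y - (B x y) • f -
      (p * B w y) • e - (B w y) • (p : ℚ) • x + (p * B w y * k : ℚ) • f := by
    intro y hey hfy
    simp only [hg_def, LinearEquiv.trans_apply, hDy y hey hfy, hTx, hEx, map_smul, map_add,
      map_sub, LinearMap.smul_apply, h.pairing', hey, hfy, hxe, hxx, smul_eq_mul]
    match_scalars <;> ring
  have hgeN : g e ∈ N := by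
    rw [hge]
    exact N.sub_mem (N.add_mem (smul_mem_of_eq_intCast he ⟨p, by simp⟩) hpx)
      (smul_mem_of_eq_intCast hf ⟨p * k, by simp⟩)
  have hgfN : g f ∈ N := by
    rw [hgf]
    exact N.add_mem (N.sub_mem (N.sub_mem (N.add_mem (ratCast_int_smul_mem hf t) hw)
      (smul_mem_of_eq_intCast he ⟨p * j, by simp⟩)) (ratCast_int_smul_mem hpx j))
      (smul_mem_of_eq_intCast hf ⟨p * j * k, by simp⟩)
  have hgxN : g x ∈ N := by
    have : g x = (t : ℚ) • (p : ℚ) • x - (2 * k : ℚ) • f - (1 - p * t : ℚ) • e +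
        ((1 - p * t) * k : ℚ) • f := by
      rw [hgy x hex hfx, hwt, hxx]
      match_scalars <;> field_simp <;> ring
    rw [this]
    exact N.add_mem (N.sub_mem (N.sub_mem (ratCast_int_smul_mem hpx t)
      (smul_mem_of_eq_intCast hf ⟨2 * k, by simp⟩))
      (smul_mem_of_eq_intCast he ⟨1 - p * t, by simp⟩))
      (smul_mem_of_eq_intCast hf ⟨(1 - p * t) * k, by simp⟩)
  have hgyN : ∀ y ∈ N, (∃ a : ℤ, B x y = a) → g y ∈ N := by
    intro y hy hxy
    obtain ⟨y, hyN, hey, hfy, m, n, rfl⟩ := h.exists_orthogonal hN he hf hy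
    obtain ⟨a, hxy⟩ := hxy
    simp only [map_add, map_smul, hxe, hxf, smul_zero, add_zero] at hxy
    obtain ⟨b, hb⟩ := hN.integral w hw y hyN
    rw [map_add, map_add, map_smul, map_smul, hgy y hey hfy, hxy, hb]
    exact N.add_mem (N.add_mem (N.add_mem (N.sub_mem (N.sub_mem
      (N.sub_mem hyN (ratCast_int_smul_mem hf a))
      (smul_mem_of_eq_intCast he ⟨p * b, by simp⟩)) (ratCast_int_smul_mem hpx b))
      (smul_mem_of_eq_intCast hf ⟨p * b * k, by simp⟩)) (ratCast_int_smul_mem hgeN m))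
      (ratCast_int_smul_mem hgfN n)
  have hN₁ := hN.pullback hg
  refine ⟨pullback g N, hN₁, hgxN, hgyN, ?_⟩
  obtain ⟨b, hb⟩ := hN.integral w hw v hv
  have h1 : PairEquiv B (pullback g N) (v + (b : ℚ) • e) (pullback g N) v :=
    pairEquiv_add_smul hB h hN₁ hgeN hgfN (hgyN v hv ⟨l, hxv⟩) hvv hev hfv b
  have h2 : PairEquiv B (pullback g N) (v + (b : ℚ) • e) N (v + ((-l : ℤ) : ℚ) • f) := by
    convert pairEquiv_pullback hg (v + (b : ℚ) • e) using 1
    rw [map_add, map_smul, hge, hgy v hev hfv, hb, hxv, Int.cast_neg]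
    match_scalars <;> ring
  exact (h1.symm.trans h2).trans (pairEquiv_add_smul hB h.swap hN hf he hv hvv hfv hev (-l))

lemma exists_prime_smul_mem {N : Submodule ℤ W} {x : W} (hx : x ∉ N)
    (hn : ∃ n : ℕ, 0 < n ∧ (n : ℚ) • x ∈ N) :
    ∃ p m : ℕ, p.Prime ∧ (m : ℚ) • x ∉ N ∧ (p : ℚ) • (m : ℚ) • x ∈ N := by
  classical
  obtain ⟨hpos, hmem⟩ := Nat.find_spec hn
  set n := Nat.find hn with hn_def
  have hn1 : n ≠ 1 := by
    rintro h1
    rw [h1, Nat.cast_one, one_smul] at hmem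
    exact hx hmem
  have hp := Nat.minFac_prime hn1
  obtain ⟨m, hm⟩ := Nat.minFac_dvd n
  refine ⟨n.minFac, m, hp, fun h => ?_, ?_⟩
  · have hm0 : 0 < m := Nat.pos_of_ne_zero (by rintro rfl; omega)
    have := Nat.find_min' hn ⟨hm0, h⟩
    nlinarith [hp.two_le]
  · rwa [smul_smul, ← Nat.cast_mul, ← hm]

/-- Two even unimodular lattices sharing a hyperbolic plane and a norm `-2` vector orthogonal to
it are isometric through an isometry fixing this vector: they are linked by a chain of
neighbours. -/
lemma pairEquiv_of_hyperbolic (hB : ∀ x y, B x y = B y x) {e f v : W}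
    (h : IsHyperbolicPair B e f) {N' : Submodule ℤ W} [IsNoetherian ℤ N']
    (hN' : IsEvenUnimodular B N') (he' : e ∈ N') (hf' : f ∈ N') (hv' : v ∈ N')
    (hvv : B v v = -2) (hev : B e v = 0) (hfv : B f v = 0) (N : Submodule ℤ W)
    (hN : IsEvenUnimodular B N) (he : e ∈ N) (hf : f ∈ N) (hv : v ∈ N) :
    PairEquiv B N v N' v := by
  induction hS : N.submoduleOf N' using WellFoundedGT.induction generalizing N with
  | ind S ih =>
  subst hS
  by_cases hle : N' ≤ N
  · have : N = N' := le_antisymm (fun y hy => hN'.mem_of_forall y fun x hx =>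
      hN.integral x (hle hx) y hy) hle
    subst this
    exact ⟨LinearEquiv.refl ℚ W, fun _ _ => rfl, fun _ => Iff.rfl, rfl⟩
  obtain ⟨x₀, hx₀', hx₀⟩ := SetLike.not_le_iff_exists.1 hle
  obtain ⟨p, m, hp, hmx, hpmx⟩ := exists_prime_smul_mem hx₀ (hN.exists_smul_mem x₀)
  have hmx' : (m : ℚ) • x₀ ∈ N' := smul_mem_of_eq_intCast hx₀' ⟨m, by simp⟩
  obtain ⟨x, hx', hex, hfx, r, s, hxrs⟩ := h.exists_orthogonal hN' he' hf' hmx'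
  have hx : x ∉ N := fun hx => hmx <| by
    rw [hxrs]
    exact N.add_mem (N.add_mem hx (ratCast_int_smul_mem he r)) (ratCast_int_smul_mem hf s)
  have hpx : (p : ℚ) • x ∈ N := by
    have : (p : ℚ) • x = (p : ℚ) • (m : ℚ) • x₀ - (p * r : ℚ) • e - (p * s : ℚ) • f := by
      rw [hxrs]
      module
    rw [this]
    exact N.sub_mem (N.sub_mem hpmx (smul_mem_of_eq_intCast he ⟨p * r, by simp⟩))
      (smul_mem_of_eq_intCast hf ⟨p * s, by simp⟩)
  obtain ⟨k, hk⟩ := hN'.even x hx'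
  obtain ⟨l, hl⟩ := hN'.integral x hx' v hv'
  obtain ⟨N₁, hN₁, hxN₁, hyN₁, hequiv⟩ :=
    exists_neighbor hB h hN he hf hv hvv hev hfv hx hp hpx hex hfx hk hl
  have hmem : ∀ y ∈ N, y ∈ N' → y ∈ N₁ := fun y hy hy' => hyN₁ y hy (hN'.integral x hx' y hy')
  refine hequiv.symm.trans (ih _ ?_ N₁ hN₁ (hmem e he he') (hmem f hf hf') (hmem v hv hv') rfl)
  refine lt_of_le_of_ne (fun y hy => hmem y hy y.2) fun heq => hx ?_
  have : (⟨x, hx'⟩ : N') ∈ N.submoduleOf N' := by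
    rw [heq]
    exact hxN₁
  exact this

/-- In an even unimodular lattice splitting off a hyperbolic plane, every norm `-2` vector is
equivalent to a given one orthogonal to the plane. -/
theorem pairEquiv_of_norm_eq (hB : ∀ x y, B x y = B y x) {e f v δ : W}
    (h : IsHyperbolicPair B e f) {M : Submodule ℤ W} [IsNoetherian ℤ M]
    (hM : IsEvenUnimodular B M) (he : e ∈ M) (hf : f ∈ M) (hv : v ∈ M)
    (hvv : B v v = -2) (hev : B e v = 0) (hfv : B f v = 0) (hδ : δ ∈ M) (hδδ : B δ δ = -2) :
    PairEquiv B M δ M v := by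
  obtain ⟨σ, hσ, hσv⟩ := exists_isometry_apply_eq hB (hvv.trans hδδ.symm) (by rw [hvv]; norm_num)
  have hN₁ := hM.pullback hσ
  have hv₁ : v ∈ pullback σ M := by rwa [mem_pullback, hσv]
  obtain ⟨c, hc, hce, w, hw, hwe⟩ := hN₁.exists_smul_pairing_eq_one h.pairing'
  obtain ⟨D, hD, hDe, hDf, hDy⟩ := exists_scaling hB h.left h.right h.pairing hc
  have hN₂ := hN₁.pullback hD
  have hDv := hDy v hev hfv
  have hv₂ : v ∈ pullback D (pullback σ M) := by rwa [mem_pullback, hDv]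
  have he₂ : e ∈ pullback D (pullback σ M) := by rwa [mem_pullback, hDe]
  have hw₂ : D.symm w ∈ pullback D (pullback σ M) := by
    rwa [mem_pullback, D.apply_symm_apply]
  have hwe₂ : B e (D.symm w) = 1 := by rw [hB, ← hD, D.apply_symm_apply, hDe, hwe]
  obtain ⟨k, hk⟩ := hN₂.even _ hw₂
  obtain ⟨f', hf'_def⟩ : ∃ f', f' = D.symm w - (k : ℚ) • e := ⟨_, rfl⟩
  have hf' : f' ∈ pullback D (pullback σ M) := by
    rw [hf'_def]
    exact Submodule.sub_mem _ hw₂ (ratCast_int_smul_mem he₂ k)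
  have hef' : B e f' = 1 := by simp [hf'_def, hwe₂, h.left]
  have hff' : B f' f' = 0 := by
    simp only [hf'_def, map_sub, map_smul, LinearMap.sub_apply, LinearMap.smul_apply, hwe₂, hk,
      hB (D.symm w) e, h.left, smul_eq_mul]
    ring
  obtain ⟨u, hu_def⟩ : ∃ u, u = f' - f - B f f' • e := ⟨_, rfl⟩
  have heu : B e u = 0 := by simp [hu_def, hef', h.left, h.pairing]
  have huf : B u f = 0 := by
    simp [hu_def, hB f' f, h.right, h.pairing]
  have huu : B u u = -2 * B f f' := by
    simp only [hu_def, map_sub, map_smul, LinearMap.sub_apply, LinearMap.smul_apply, hff', hef',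
      h.left, h.right, h.pairing, h.pairing', hB f' f, hB f' e, smul_eq_mul]
    ring
  obtain ⟨E, hE, hEx, -⟩ := exists_eichler hB h.left heu
  have hN₃ := hN₂.pullback hE
  have hEe : E e = e := by
    rw [hEx, h.left, hB u e, heu]
    module
  have hEf : E f = f' := by
    rw [hEx, h.pairing, huf, huu, hu_def]
    module
  have hEv : ∀ a : ℚ, E (v + a • e) = v + (a - B u v) • e := by
    intro a
    rw [map_add, map_smul, hEe, hEx, hev]
    module
  have he₃ : e ∈ pullback E (pullback D (pullback σ M)) := by rwa [mem_pullback, hEe]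
  have hf₃ : f ∈ pullback E (pullback D (pullback σ M)) := by rwa [mem_pullback, hEf]
  have hv₃' : v + B u v • e ∈ pullback E (pullback D (pullback σ M)) := by
    rw [mem_pullback, hEv, sub_self, zero_smul, add_zero]
    exact hv₂
  obtain ⟨b, hb⟩ := hN₃.integral f hf₃ _ hv₃'
  simp only [map_add, map_smul, hfv, h.pairing', smul_eq_mul, zero_add, mul_one] at hb
  have hv₃ : v ∈ pullback E (pullback D (pullback σ M)) := by
    have := Submodule.sub_mem _ hv₃' (ratCast_int_smul_mem he₃ b)
    rwa [hb, add_sub_cancel_right] at this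
  have h1 : PairEquiv B (pullback E (pullback D (pullback σ M))) (v + (b : ℚ) • e) M δ := by
    convert ((pairEquiv_pullback hE _).trans (pairEquiv_pullback hD _)).trans
      (pairEquiv_pullback hσ _) using 1
    rw [hEv, hb, sub_self, zero_smul, add_zero, hDv, hσv]
  exact (h1.symm.trans (pairEquiv_add_smul hB h hN₃ he₃ hf₃ hv₃ hvv hev hfv b)).trans
    (pairEquiv_of_hyperbolic hB h hM he hf hv hvv hev hfv _ hN₃ he₃ hf₃ hv₃)

end Abstract

section Concrete

/-- The standard lattice in `ℚⁿ`. -/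
def integerVectors (n : Type*) : Submodule ℤ (n → ℚ) :=
  LinearMap.range ((Int.castAddHom ℚ).toIntLinearMap.compLeft n)

/-- The inclusion of `ℤⁿ` into `ℚⁿ`, as an isomorphism onto the standard lattice. -/
noncomputable def integerVectorsEquiv (n : Type*) : (n → ℤ) ≃ₗ[ℤ] integerVectors n :=
  LinearEquiv.ofInjective _ fun x y h => by
    ext i
    exact Int.cast_injective (congrFun h i)

lemma coe_integerVectorsEquiv {n : Type*} (x : n → ℤ) :
    (integerVectorsEquiv n x : n → ℚ) = fun i => (x i : ℚ) := rfl

instance {n : Type*} [Finite n] : IsNoetherian ℤ (integerVectors n) :=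
  isNoetherian_of_linearEquiv (integerVectorsEquiv n)

lemma mem_integerVectors {n : Type*} {x : n → ℚ} :
    x ∈ integerVectors n ↔ ∃ y : n → ℤ, x = fun i => (y i : ℚ) :=
  ⟨fun ⟨y, hy⟩ => ⟨y, hy.symm⟩, fun ⟨y, hy⟩ => ⟨y, hy.symm⟩⟩

variable {n : Type*} [Fintype n]

lemma even_dotProduct_mulVec {G : Matrix n n ℤ} (hG : G.IsSymm) (hdiag : ∀ i, Even (G i i))
    (x : n → ℤ) : Even (x ⬝ᵥ G *ᵥ x) := by
  rw [← ZMod.intCast_eq_zero_iff_even]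
  have : x ⬝ᵥ G *ᵥ x = ∑ p : n × n, x p.1 * (G p.1 p.2 * x p.2) := by
    simp only [dotProduct, mulVec, Finset.mul_sum, Fintype.sum_prod_type]
  rw [this, Int.cast_sum]
  refine Finset.sum_involution (fun p _ => p.swap) (fun p _ => ?_) (fun p _ hp h => hp ?_)
    (fun p _ => Finset.mem_univ _) (fun p _ => p.swap_swap)
  · rw [← Int.cast_add, ZMod.intCast_eq_zero_iff_even, Prod.fst_swap, Prod.snd_swap,
      hG.apply p.1 p.2]
    exact ⟨x p.1 * (G p.1 p.2 * x p.2), by ring⟩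
  · have h12 : p.2 = p.1 := congrArg Prod.fst h
    rw [ZMod.intCast_eq_zero_iff_even, h12]
    exact ((hdiag p.1).mul_right _).mul_left _

variable [DecidableEq n]

/-- The rational bilinear form attached to an integral Gram matrix. -/
noncomputable def ratForm (G : Matrix n n ℤ) : LinearMap.BilinForm ℚ (n → ℚ) :=
  Matrix.toBilin' (G.map (Int.castRingHom ℚ))

lemma ratForm_intCast (G : Matrix n n ℤ) (x y : n → ℤ) :
    ratForm G (fun i => (x i : ℚ)) (fun i => (y i : ℚ)) = (x ⬝ᵥ G *ᵥ y : ℤ) := by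
  simp [ratForm, Matrix.toBilin'_apply', dotProduct, mulVec]

lemma ratForm_comm {G : Matrix n n ℤ} (hG : G.IsSymm) (x y : n → ℚ) :
    ratForm G x y = ratForm G y x := by
  rw [ratForm, Matrix.toBilin'_apply', Matrix.toBilin'_apply', dotProduct_mulVec, dotProduct_comm,
    ← mulVec_transpose, ← transpose_map, hG]

lemma isEvenUnimodular_integerVectors {G : Matrix n n ℤ} (hG : G.IsSymm)
    (hdiag : ∀ i, Even (G i i)) (hdet : IsUnit G.det) :
    IsEvenUnimodular (ratForm G) (integerVectors n) where
  mem_of_forall y hy := by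
    have h : ∀ i, ∃ k : ℤ, (G.map (Int.castRingHom ℚ) *ᵥ y) i = k := fun i => by
      obtain ⟨k, hk⟩ := hy (Pi.single i 1)
        (mem_integerVectors.2 ⟨Pi.single i 1, by ext j; simp [Pi.single_apply]⟩)
      exact ⟨k, by simpa [ratForm, Matrix.toBilin'_apply'] using hk⟩
    choose k hk using h
    refine mem_integerVectors.2 ⟨G⁻¹ *ᵥ k, ?_⟩
    have h1 : (G⁻¹.map (Int.castRingHom ℚ)) * G.map (Int.castRingHom ℚ) = 1 := by
      rw [← Matrix.map_mul, Matrix.nonsing_inv_mul _ hdet]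
      simp
    have hk' : G.map (Int.castRingHom ℚ) *ᵥ y = fun i => (k i : ℚ) := funext hk
    have h2 : y = G⁻¹.map (Int.castRingHom ℚ) *ᵥ (fun i => (k i : ℚ)) := by
      rw [← hk', mulVec_mulVec, h1, one_mulVec]
    rw [h2]
    ext i
    simp [mulVec, dotProduct]
  integral x hx y hy := by
    obtain ⟨x, rfl⟩ := mem_integerVectors.1 hx
    obtain ⟨y, rfl⟩ := mem_integerVectors.1 hy
    exact ⟨_, ratForm_intCast G x y⟩
  even x hx := by
    obtain ⟨x, rfl⟩ := mem_integerVectors.1 hx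
    obtain ⟨k, hk⟩ := even_dotProduct_mulVec hG hdiag x
    exact ⟨k, by rw [ratForm_intCast, hk]; push_cast; ring⟩
  exists_smul_mem x := by
    refine ⟨∏ i, (x i).den, Finset.prod_pos fun i _ => (x i).den_pos, ?_⟩
    refine mem_integerVectors.2
      ⟨fun i => (x i).num * ∏ j ∈ Finset.univ.erase i, ((x j).den : ℤ), ?_⟩
    ext i
    rw [Pi.smul_apply, smul_eq_mul, ← Finset.mul_prod_erase _ _ (Finset.mem_univ i)]
    push_cast
    rw [mul_right_comm, mul_comm ((x i).den : ℚ), Rat.mul_den_eq_num]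

/-- Norm `-2` vectors are equivalent in an even unimodular lattice containing a hyperbolic plane
and a norm `-2` vector orthogonal to it. -/
theorem exists_linearEquiv_of_norm_eq {G : Matrix n n ℤ} (hG : G.IsSymm)
    (hdiag : ∀ i, Even (G i i)) (hdet : IsUnit G.det) {e f v : n → ℤ}
    (hee : e ⬝ᵥ G *ᵥ e = 0) (hff : f ⬝ᵥ G *ᵥ f = 0) (hef : e ⬝ᵥ G *ᵥ f = 1)
    (hev : e ⬝ᵥ G *ᵥ v = 0) (hfv : f ⬝ᵥ G *ᵥ v = 0) (hvv : v ⬝ᵥ G *ᵥ v = -2) {δ₁ δ₂ : n → ℤ}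
    (h₁ : δ₁ ⬝ᵥ G *ᵥ δ₁ = -2) (h₂ : δ₂ ⬝ᵥ G *ᵥ δ₂ = -2) :
    ∃ g : (n → ℤ) ≃ₗ[ℤ] (n → ℤ),
      (∀ x y, g x ⬝ᵥ G *ᵥ g y = x ⬝ᵥ G *ᵥ y) ∧ g δ₁ = δ₂ := by
  have hB := ratForm_comm hG
  have hM := isEvenUnimodular_integerVectors hG hdiag hdet
  have hmem : ∀ x : n → ℤ, (fun i => (x i : ℚ)) ∈ integerVectors n := fun x =>
    mem_integerVectors.2 ⟨x, rfl⟩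
  have hpair : IsHyperbolicPair (ratForm G) (fun i => (e i : ℚ)) (fun i => (f i : ℚ)) :=
    ⟨by simp [ratForm_intCast, hee], by simp [ratForm_intCast, hff],
      by simp [ratForm_intCast, hef], by rw [hB]; simp [ratForm_intCast, hef]⟩
  have key : ∀ δ : n → ℤ, δ ⬝ᵥ G *ᵥ δ = -2 →
      PairEquiv (ratForm G) (integerVectors n) (fun i => (δ i : ℚ)) (integerVectors n)
        (fun i => (v i : ℚ)) := fun δ hδ =>
    pairEquiv_of_norm_eq hB hpair hM (hmem e) (hmem f) (hmem v) (by simp [ratForm_intCast, hvv])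
      (by simp [ratForm_intCast, hev]) (by simp [ratForm_intCast, hfv]) (hmem δ)
      (by simp [ratForm_intCast, hδ])
  obtain ⟨g, hg, hgM, hgδ⟩ := (key δ₁ h₁).trans (key δ₂ h₂).symm
  let γ : integerVectors n ≃ₗ[ℤ] integerVectors n :=
    (g.restrictScalars ℤ).ofSubmodules _ _ <| by
      ext x
      refine ⟨?_, fun hx => ⟨g.symm x, ?_, g.apply_symm_apply x⟩⟩
      · rintro ⟨y, hy, rfl⟩
        exact (hgM y).2 hy
      · exact (hgM _).1 (by simpa using hx)
  have hγ : ∀ x : n → ℤ, (fun i => (((integerVectorsEquiv n).symm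
      (γ (integerVectorsEquiv n x)) i : ℤ) : ℚ)) = g (fun i => (x i : ℚ)) := fun x => by
    rw [← coe_integerVectorsEquiv, LinearEquiv.apply_symm_apply]
    rfl
  refine ⟨((integerVectorsEquiv n).trans γ).trans (integerVectorsEquiv n).symm, fun x y => ?_, ?_⟩
  · simp only [LinearEquiv.trans_apply]
    rw [← Int.cast_inj (α := ℚ), ← ratForm_intCast, ← ratForm_intCast, hγ, hγ, hg]
  · have h := hγ δ₁
    rw [hgδ] at h
    ext i
    exact Int.cast_injective (congrFun h i)

end Concrete

lemma gramL_isSymm (a b : ℕ) : (gramL a b).IsSymm := by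
  have hU : gramUᵀ = gramU := by decide
  have hE : gramE8negᵀ = gramE8neg := by
    rw [gramE8neg, transpose_neg, CartanMatrix.E₈_transpose]
  rw [Matrix.IsSymm, gramL, fromBlocks_transpose, blockDiagonal_transpose, blockDiagonal_transpose,
    transpose_zero, transpose_zero, hU, hE]

lemma even_gramL_diag (a b : ℕ) (i : IdxL a b) : Even (gramL a b i i) := by
  obtain ⟨i, k⟩ | ⟨i, k⟩ := i
  · fin_cases i <;> simp [gramL, gramU]
  · simp [gramL, gramE8neg]

lemma isUnit_det_gramL (a b : ℕ) : IsUnit (gramL a b).det := by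
  have hU : IsUnit gramU.det := by simp [gramU, det_fin_two]
  have hE : IsUnit gramE8neg.det := by simp [gramE8neg, det_neg, CartanMatrix.E₈_det]
  rw [gramL, det_fromBlocks_zero₂₁, det_blockDiagonal, det_blockDiagonal, Finset.prod_const,
    Finset.prod_const]
  exact (hU.pow _).mul (hE.pow _)

lemma single_gramL_single {a b : ℕ} (i j : IdxL a b) :
    Pi.single i 1 ⬝ᵥ gramL a b *ᵥ Pi.single j 1 = gramL a b i j := by
  simp

lemma exists_neg_of_hyperbolicPlane {x y : IdxL 1 0 → ℤ} (hx : bilL 1 0 x x = -2)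
    (hy : bilL 1 0 y y = -2) : x = y ∨ -x = y := by
  have hform : ∀ z : IdxL 1 0 → ℤ,
      bilL 1 0 z z = 2 * (z (Sum.inl (0, 0)) * z (Sum.inl (1, 0))) := by
    intro z
    simp [bilL, gramL, gramU, dotProduct, mulVec, Fintype.sum_prod_type, Fin.sum_univ_two]
    ring
  have hsol : ∀ z : IdxL 1 0 → ℤ, bilL 1 0 z z = -2 →
      z (Sum.inl (0, 0)) = 1 ∧ z (Sum.inl (1, 0)) = -1 ∨
        z (Sum.inl (0, 0)) = -1 ∧ z (Sum.inl (1, 0)) = 1 := by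
    intro z hz
    rw [hform] at hz
    exact Int.mul_eq_neg_one_iff_eq_one_or_neg_one.1 (by omega)
  have hext : ∀ z w : IdxL 1 0 → ℤ, z (Sum.inl (0, 0)) = w (Sum.inl (0, 0)) →
      z (Sum.inl (1, 0)) = w (Sum.inl (1, 0)) → z = w := by
    intro z w h0 h1
    ext i
    obtain ⟨i, k⟩ | ⟨-, k⟩ := i
    · rw [Subsingleton.elim k 0]
      fin_cases i
      exacts [h0, h1]
    · exact k.elim0
  rcases hsol x hx with ⟨h1, h2⟩ | ⟨h1, h2⟩ <;> rcases hsol y hy with ⟨h3, h4⟩ | ⟨h3, h4⟩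
  · exact Or.inl (hext _ _ (by rw [h1, h3]) (by rw [h2, h4]))
  · exact Or.inr (hext _ _ (by simp [h1, h3]) (by simp [h2, h4]))
  · exact Or.inr (hext _ _ (by simp [h1, h3]) (by simp [h2, h4]))
  · exact Or.inl (hext _ _ (by rw [h1, h3]) (by rw [h2, h4]))

/-- Away from `U`, some norm `-2` vector is orthogonal to the first hyperbolic plane. -/
lemma exists_norm_neg_two_orthogonal {a b : ℕ} (h : 0 < a ∨ 0 < b) :
    ∃ v : IdxL (a + 1) b → ℤ, Pi.single (Sum.inl (0, 0)) 1 ⬝ᵥ gramL (a + 1) b *ᵥ v = 0 ∧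
      Pi.single (Sum.inl (1, 0)) 1 ⬝ᵥ gramL (a + 1) b *ᵥ v = 0 ∧
      v ⬝ᵥ gramL (a + 1) b *ᵥ v = -2 := by
  obtain h | h := h
  · have h0 : (0 : Fin (a + 1)) ≠ Fin.last a := Fin.ne_of_val_ne (by simpa using h.ne)
    refine ⟨Pi.single (Sum.inl (0, Fin.last a)) 1 - Pi.single (Sum.inl (1, Fin.last a)) 1,
      ?_, ?_, ?_⟩ <;>
    simp only [mulVec_sub, dotProduct_sub, sub_dotProduct, single_gramL_single] <;>
    simp [gramL, gramU, blockDiagonal_apply, h0]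
  · refine ⟨Pi.single (Sum.inr (0, ⟨0, h⟩)) 1, ?_, ?_, ?_⟩ <;>
    simp only [single_gramL_single] <;> simp [gramL, gramE8neg]

/-- for `M = U^a ⊕ E8(−1)^b` with `a ≥ 1`, the isometry group `O(M)`
acts transitively on the `(−2)`-vectors of `M`. -/
theorem statement13 (a b : ℕ) (ha : 1 ≤ a)
    (δ₁ δ₂ : IdxL a b → ℤ)
    (h₁ : bilL a b δ₁ δ₁ = -2) (h₂ : bilL a b δ₂ δ₂ = -2) :
    ∃ g : (IdxL a b → ℤ) ≃ₗ[ℤ] (IdxL a b → ℤ),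
      (∀ x y, bilL a b (g x) (g y) = bilL a b x y) ∧ g δ₁ = δ₂ := by
  obtain ⟨a, rfl⟩ := Nat.exists_eq_add_of_le' ha
  by_cases h : 0 < a ∨ 0 < b
  · obtain ⟨v, hev, hfv, hvv⟩ := exists_norm_neg_two_orthogonal h
    refine exists_linearEquiv_of_norm_eq (gramL_isSymm _ _) (even_gramL_diag _ _)
      (isUnit_det_gramL _ _) ?_ ?_ ?_ hev hfv hvv h₁ h₂ <;>
    rw [single_gramL_single] <;> simp [gramL, gramU]
  · obtain ⟨rfl, rfl⟩ : a = 0 ∧ b = 0 := by omega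
    obtain rfl | rfl := exists_neg_of_hyperbolicPlane h₁ h₂
    · exact ⟨LinearEquiv.refl ℤ _, fun _ _ => rfl, rfl⟩
    · exact ⟨LinearEquiv.neg ℤ, fun x y => by simp [bilL, mulVec_neg], rfl⟩
end

section
/- Let Λ_K3 = U ⊕ L with L = U ⊕ U ⊕ E8(−1) ⊕ E8(−1), where the first summand U has basis e_1, e_2 with ⟨e_1,e_1⟩ = ⟨e_2,e_2⟩ = 0 and ⟨e_1,e_2⟩ = 1. Fix n ≥ 1 and set l = e_1 + n e_2. Let δ ∈ Λ_K3 with ⟨δ,δ⟩ = −2. Then there exists an isometry σ ∈ O(Λ_K3) with σ(l) = l such that ⟨σ(δ), e_1⟩ · ⟨σ(δ), e_2⟩ < 0; equivalently, writing σ(δ) = n_1 e_1 + n_2 e_2 + μ with μ ∈ L, the projection of σ(δ) to the first U summand has negative self-intersection, i.e. ⟨μ, μ⟩ > 0. -/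
open Matrix

/-- Index type of `Λ_K3 = U ⊕ L` with `L = U² ⊕ E8(−1)²`; the distinguished first `U`
summand has basis `e₁ = inl 0`, `e₂ = inl 1`. -/
abbrev Idx16 := Fin 2 ⊕ IdxL 2 2

/-- Gram matrix of `Λ_K3 = U ⊕ L`. -/
def gram16 : Matrix Idx16 Idx16 ℤ := Matrix.fromBlocks gramU 0 0 (gramL 2 2)

/-- The bilinear form of `Λ_K3 = U ⊕ L`. -/
def bil16 (x y : Idx16 → ℤ) : ℤ := x ⬝ᵥ gram16.mulVec y

/-- The basis vector `e₁` of the distinguished `U`. -/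
def eOne : Idx16 → ℤ := Pi.single (Sum.inl 0) 1

/-- The basis vector `e₂` of the distinguished `U`. -/
def eTwo : Idx16 → ℤ := Pi.single (Sum.inl 1) 1

section Transvection

variable {M : Type*} [AddCommGroup M] (B : LinearMap.BilinForm ℤ M)

/-- The Eichler transvection along an isotropic vector `e` and a vector `f` orthogonal to `e`
with `⟨f, f⟩ = -2n`, scaled by `m`. -/
def eichlerMap (e f : M) (n m : ℤ) : M →ₗ[ℤ] M :=
  LinearMap.id + (m • B e).smulRight f + ((n * m ^ 2) • B e).smulRight e
    - (m • B f).smulRight e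

lemma eichlerMap_apply (e f : M) (n m : ℤ) (x : M) :
    eichlerMap B e f n m x
      = x + (m * B e x) • f + (n * m ^ 2 * B e x) • e - (m * B f x) • e := by
  simp only [eichlerMap, LinearMap.add_apply, LinearMap.sub_apply, LinearMap.id_apply,
    LinearMap.smulRight_apply, LinearMap.smul_apply, smul_eq_mul]

variable {B} {e f : M} {n : ℤ}

lemma eichlerMap_neg_apply (hee : B e e = 0) (hef : B e f = 0) (hfe : B f e = 0)
    (hff : B f f = -2 * n) (m : ℤ) (x : M) :
    eichlerMap B e f n m (eichlerMap B e f n (-m) x) = x := by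
  simp only [eichlerMap_apply, map_add, map_sub, map_smul, hee, hef, hfe, hff]
  module

/-- The Eichler transvection as a linear automorphism. -/
def eichlerEquiv (hee : B e e = 0) (hef : B e f = 0) (hfe : B f e = 0)
    (hff : B f f = -2 * n) (m : ℤ) : M ≃ₗ[ℤ] M :=
  LinearEquiv.ofLinearMap (eichlerMap B e f n m) (eichlerMap B e f n (-m))
    (LinearMap.ext fun x => eichlerMap_neg_apply hee hef hfe hff m x)
    (LinearMap.ext fun x => by
      simpa using eichlerMap_neg_apply hee hef hfe hff (-m) x)

lemma eichlerEquiv_apply (hee : B e e = 0) (hef : B e f = 0) (hfe : B f e = 0)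
    (hff : B f f = -2 * n) (m : ℤ) (x : M) :
    eichlerEquiv hee hef hfe hff m x
      = x + (m * B e x) • f + (n * m ^ 2 * B e x) • e - (m * B f x) • e :=
  eichlerMap_apply B e f n m x

lemma eichlerEquiv_isometry (hB : ∀ x y, B x y = B y x) (hee : B e e = 0) (hef : B e f = 0)
    (hfe : B f e = 0) (hff : B f f = -2 * n) (m : ℤ) (x y : M) :
    B (eichlerEquiv hee hef hfe hff m x) (eichlerEquiv hee hef hfe hff m y) = B x y := by
  simp only [eichlerEquiv_apply, map_add, map_sub, map_smul, LinearMap.add_apply,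
    LinearMap.sub_apply, LinearMap.smul_apply, hee, hef, hfe, hff, smul_eq_mul, hB x e, hB x f]
  ring

end Transvection

lemma exists_mul_neg_of_ne_zero {n c : ℤ} (hn : 1 ≤ n) (hc : c ≠ 0) (a b : ℤ) :
    ∃ m : ℤ, (b - n * (m * c)) * (a + m * c) < 0 := by
  refine ⟨c * (|a| + |b| + 1), ?_⟩
  have hc2 : 1 ≤ c * c := mul_self_pos.mpr hc
  have ha := neg_abs_le a
  have hb := le_abs_self b
  have ha0 := abs_nonneg a
  have hb0 := abs_nonneg b
  have hs : |a| + |b| + 1 ≤ c * (|a| + |b| + 1) * c := by nlinarith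
  have hns : c * (|a| + |b| + 1) * c ≤ n * (c * (|a| + |b| + 1) * c) := by nlinarith
  exact mul_neg_of_neg_of_pos (by linarith) (by linarith)

/-- In a lattice containing two orthogonal hyperbolic planes `⟨e₁, e₂⟩` and `⟨p, q⟩`, every
`(-2)`-vector can be moved by an isometry fixing `e₁ + n e₂` so that its projection to the first
plane has negative square. -/
lemma exists_isometry_mul_neg {M : Type*} [AddCommGroup M] (B : LinearMap.BilinForm ℤ M)
    (hB : ∀ x y, B x y = B y x) {e₁ e₂ p q : M}
    (h11 : B e₁ e₁ = 0) (h12 : B e₁ e₂ = 1) (h22 : B e₂ e₂ = 0)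
    (hpp : B p p = 0) (hpq : B p q = 1) (hqq : B q q = 0)
    (hp1 : B p e₁ = 0) (hp2 : B p e₂ = 0) (hq1 : B q e₁ = 0) (hq2 : B q e₂ = 0)
    {n : ℤ} (hn : 1 ≤ n) {δ : M} (hδ : B δ δ = -2) :
    ∃ g : M ≃ₗ[ℤ] M, (∀ x y, B (g x) (g y) = B x y) ∧ g (e₁ + n • e₂) = e₁ + n • e₂ ∧
      B (g δ) e₁ * B (g δ) e₂ < 0 := by
  have h21 : B e₂ e₁ = 1 := by rw [hB, h12]
  by_cases hneg : B δ e₁ * B δ e₂ < 0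
  · exact ⟨LinearEquiv.refl ℤ M, fun _ _ => rfl, rfl, hneg⟩
  obtain ⟨e, hee, he1, he2, hc⟩ : ∃ e, B e e = 0 ∧ B e e₁ = 0 ∧ B e e₂ = 0 ∧ B e δ ≠ 0 := by
    by_cases hpδ : B p δ = 0
    swap
    · exact ⟨p, hpp, hp1, hp2, hpδ⟩
    by_cases hqδ : B q δ = 0
    swap
    · exact ⟨q, hqq, hq1, hq2, hqδ⟩
    have hqp : B q p = 1 := by rw [hB, hpq]
    have hδp : B δ p = 0 := by rw [hB, hpδ]
    have hδq : B δ q = 0 := by rw [hB, hqδ]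
    have h1p : B e₁ p = 0 := by rw [hB, hp1]
    have h2p : B e₂ p = 0 := by rw [hB, hp2]
    have h1q : B e₁ q = 0 := by rw [hB, hq1]
    have h2q : B e₂ q = 0 := by rw [hB, hq2]
    refine ⟨p + (δ - B δ e₂ • e₁ - B δ e₁ • e₂) + (1 + B δ e₁ * B δ e₂) • q, ?_, ?_, ?_, ?_⟩ <;>
      simp only [map_add, map_sub, map_smul, LinearMap.add_apply, LinearMap.sub_apply,
        LinearMap.smul_apply, smul_eq_mul, h11, h12, h22, h21, hpp, hpq, hqq, hp1, hp2, hq1, hq2,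
        hqp, hδp, hδq, h1p, h2p, h1q, h2q, hpδ, hqδ, hδ, hB e₁ δ, hB e₂ δ]
    · ring
    · ring
    · ring
    · intro h
      apply hneg
      linarith
  have h1e : B e₁ e = 0 := by rw [hB, he1]
  have h2e : B e₂ e = 0 := by rw [hB, he2]
  have hef : B e (e₁ - n • e₂) = 0 := by simp [he1, he2]
  have hfe : B (e₁ - n • e₂) e = 0 := by rw [hB, hef]
  have hff : B (e₁ - n • e₂) (e₁ - n • e₂) = -2 * n := by
    simp [h11, h12, h21, h22]
    ring
  obtain ⟨m, hm⟩ := exists_mul_neg_of_ne_zero hn hc (B δ e₂) (B δ e₁)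
  refine ⟨eichlerEquiv hee hef hfe hff m, eichlerEquiv_isometry hB hee hef hfe hff m, ?_, ?_⟩
  · simp [eichlerEquiv_apply, he1, he2, h11, h12, h21, h22]
  · convert hm using 2 <;> simp [eichlerEquiv_apply, he1, he2, h11, h12, h21, h22]
    ring

lemma gram16_isSymm : gram16.IsSymm := by
  have hU : gramU.IsSymm := by decide
  have hE : gramE8neg.IsSymm := by decide
  refine Matrix.IsSymm.fromBlocks hU (by simp) (Matrix.IsSymm.fromBlocks ?_ (by simp) ?_) <;>
    simp only [Matrix.IsSymm, Matrix.blockDiagonal_transpose, hU.eq, hE.eq]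

lemma bil16_eq_toBilin' (x y : Idx16 → ℤ) : bil16 x y = Matrix.toBilin' gram16 x y := by
  rw [Matrix.toBilin'_apply', bil16]

lemma bil16_comm (x y : Idx16 → ℤ) : bil16 x y = bil16 y x := by
  rw [bil16, bil16, Matrix.dotProduct_mulVec, ← Matrix.mulVec_transpose, gram16_isSymm.eq,
    dotProduct_comm]

/-- for `l = e₁ + n e₂` and any `δ` with `⟨δ,δ⟩ = −2` there is an
isometry `σ` of `Λ_K3` fixing `l` such that `⟨σ(δ),e₁⟩·⟨σ(δ),e₂⟩ < 0`, i.e. the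
projection of `σ(δ)` to the first `U` summand has negative self-intersection. -/
theorem statement16 (n : ℕ) (hn : 1 ≤ n)
    (l : Idx16 → ℤ) (hl : l = eOne + (n : ℤ) • eTwo)
    (δ : Idx16 → ℤ) (hδ : bil16 δ δ = -2) :
    ∃ g : (Idx16 → ℤ) ≃ₗ[ℤ] (Idx16 → ℤ),
      (∀ x y, bil16 (g x) (g y) = bil16 x y) ∧ g l = l ∧
      bil16 (g δ) eOne * bil16 (g δ) eTwo < 0 := by
  subst hl
  simp only [bil16_eq_toBilin'] at hδ ⊢
  refine exists_isometry_mul_neg (Matrix.toBilin' gram16)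
    (fun x y => by simpa only [bil16_eq_toBilin'] using bil16_comm x y)
    (p := Pi.single (Sum.inr (Sum.inl (0, 0))) 1) (q := Pi.single (Sum.inr (Sum.inl (1, 0))) 1)
    ?_ ?_ ?_ ?_ ?_ ?_ ?_ ?_ ?_ ?_ (by exact_mod_cast hn) hδ <;>
  · simp only [eOne, eTwo, Matrix.toBilin'_single]
    decide
end
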